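/- Suppose A ∈ ℝ^{n×n} is symmetric with nonnegative entries, has minimum node degree at least α ≥ 0, and satisfies ‖A‖₂ ≤ β_A; suppose ‖X‖_F ≤ β_X, ‖W^{(m,l)}‖₂ ≤ β_W for all m ∈ {1,…,M} and l ∈ {1,…,L}, σ is ρ-Lipschitz with σ(0) = 0, and λ ∈ ℝ^M satisfies λ_m ≥ 0 and ∑_m λ_m = 1. Then the ensemble representation g = ∑_{m=1}^M λ_m (1/n) 1ᵀ X^{(m,L)} satisfies ‖g‖ ≤ (1/√n) ρ^L β_W^L β_X (1 + β_A)^L (1 + α)^{−L}. -/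

import Mathlib

open Matrix BigOperators Finset

noncomputable def specNorm {m n : Type*} [Fintype m] [Fintype n] [DecidableEq n]
    (A : Matrix m n ℝ) : ℝ :=
  ‖LinearMap.toContinuousLinearMap (Matrix.toEuclideanLin A)‖

noncomputable def frobNorm {m n : Type*} [Fintype m] [Fintype n] (A : Matrix m n ℝ) : ℝ :=
  Real.sqrt (∑ i, ∑ j, (A i j) ^ 2)

noncomputable def vecNorm {ι : Type*} [Fintype ι] (v : ι → ℝ) : ℝ :=
  Real.sqrt (∑ i, (v i) ^ 2)

noncomputable def normAdj {v : Type*} [Fintype v] [DecidableEq v]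
    (A : Matrix v v ℝ) : Matrix v v ℝ :=
  Matrix.diagonal (fun i => (Real.sqrt (∑ j, (1 + A) i j))⁻¹) * (1 + A) *
    Matrix.diagonal (fun i => (Real.sqrt (∑ j, (1 + A) i j))⁻¹)

noncomputable def deltaD {v : Type*} [Fintype v] [DecidableEq v]
    (A ΔA : Matrix v v ℝ) : Matrix v v ℝ :=
  1 - Matrix.diagonal (fun i => Real.sqrt (∑ j, (1 + (A + ΔA)) i j)) *
      Matrix.diagonal (fun i => (Real.sqrt (∑ j, (1 + A) i j))⁻¹)

noncomputable def gcn {v : Type*} [Fintype v] (U : Matrix v v ℝ) (σ : ℝ → ℝ)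
    {d : ℕ → ℕ} (W : (l : ℕ) → Matrix (Fin (d l)) (Fin (d (l + 1))) ℝ)
    (X0 : Matrix v (Fin (d 0)) ℝ) : (l : ℕ) → Matrix v (Fin (d l)) ℝ
  | 0 => X0
  | l + 1 => (U * gcn U σ W X0 l * W l).map σ

noncomputable def avgPool {v p : Type*} [Fintype v] [Fintype p]
    (X : Matrix v p ℝ) : p → ℝ :=
  fun j => (∑ i, X i j) / (Fintype.card v : ℝ)

noncomputable def ensembleRep {n M : ℕ} {d : ℕ → ℕ} (A : Matrix (Fin n) (Fin n) ℝ)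
    (σ : ℝ → ℝ) (W : Fin M → (l : ℕ) → Matrix (Fin (d l)) (Fin (d (l + 1))) ℝ)
    (X : Matrix (Fin n) (Fin (d 0)) ℝ) (lam : Fin M → ℝ) (L : ℕ) : Fin (d L) → ℝ :=
  fun j => ∑ m, lam m * avgPool (gcn (normAdj A) σ (W m) X L) j

def principalSub {n : ℕ} (A : Matrix (Fin n) (Fin n) ℝ) (s : Finset (Fin n)) :
    Matrix s s ℝ :=
  A.submatrix (fun i => (i : Fin n)) (fun j => (j : Fin n))

def rowSub {n p : ℕ} (X : Matrix (Fin n) (Fin p) ℝ) (s : Finset (Fin n)) :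
    Matrix s (Fin p) ℝ :=
  X.submatrix (fun i => (i : Fin n)) id

section NormBounds

open scoped Matrix.Norms.L2Operator

theorem specNorm_eq_l2_opNorm {m n : Type*} [Fintype m] [Fintype n] [DecidableEq n]
    (A : Matrix m n ℝ) : specNorm A = ‖A‖ :=
  (Matrix.l2_opNorm_def A).symm

theorem specNorm_nonneg {m n : Type*} [Fintype m] [Fintype n] [DecidableEq n]
    (A : Matrix m n ℝ) : 0 ≤ specNorm A :=
  norm_nonneg _

theorem specNorm_transpose {m n : Type*} [Fintype m] [Fintype n] [DecidableEq m] [DecidableEq n]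
    (A : Matrix m n ℝ) : specNorm Aᵀ = specNorm A := by
  rw [specNorm_eq_l2_opNorm, specNorm_eq_l2_opNorm, ← Matrix.conjTranspose_eq_transpose_of_trivial,
    Matrix.l2_opNorm_conjTranspose]

theorem vecNorm_eq_norm_toLp {ι : Type*} [Fintype ι] (v : ι → ℝ) :
    vecNorm v = ‖WithLp.toLp 2 v‖ := by
  simp [vecNorm, EuclideanSpace.norm_eq]

theorem vecNorm_sq {ι : Type*} [Fintype ι] (v : ι → ℝ) : vecNorm v ^ 2 = ∑ i, v i ^ 2 :=
  Real.sq_sqrt (by positivity)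

theorem frobNorm_sq {m n : Type*} [Fintype m] [Fintype n] (A : Matrix m n ℝ) :
    frobNorm A ^ 2 = ∑ i, ∑ j, A i j ^ 2 :=
  Real.sq_sqrt (by positivity)

theorem frobNorm_nonneg {m n : Type*} [Fintype m] [Fintype n] (A : Matrix m n ℝ) :
    0 ≤ frobNorm A :=
  Real.sqrt_nonneg _

theorem frobNorm_transpose {m n : Type*} [Fintype m] [Fintype n] (A : Matrix m n ℝ) :
    frobNorm Aᵀ = frobNorm A :=
  congrArg Real.sqrt Finset.sum_comm

theorem vecNorm_mulVec_le {m n : Type*} [Fintype m] [Fintype n] [DecidableEq n]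
    (A : Matrix m n ℝ) (v : n → ℝ) : vecNorm (A *ᵥ v) ≤ specNorm A * vecNorm v := by
  rw [vecNorm_eq_norm_toLp, vecNorm_eq_norm_toLp, specNorm_eq_l2_opNorm]
  exact Matrix.l2_opNorm_mulVec A (WithLp.toLp 2 v)

theorem frobNorm_mul_le_specNorm_mul {m n p : Type*} [Fintype m] [Fintype n] [Fintype p]
    [DecidableEq n] (A : Matrix m n ℝ) (B : Matrix n p ℝ) :
    frobNorm (A * B) ≤ specNorm A * frobNorm B := by
  refine le_of_pow_le_pow_left₀ two_ne_zero (mul_nonneg (specNorm_nonneg A) (frobNorm_nonneg B)) ?_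
  rw [mul_pow, frobNorm_sq, frobNorm_sq, Finset.sum_comm,
    Finset.sum_comm (f := fun i j => B i j ^ 2),
    Finset.mul_sum]
  refine Finset.sum_le_sum fun j _ => ?_
  have h := pow_le_pow_left₀ (Real.sqrt_nonneg _) (vecNorm_mulVec_le A fun i => B i j) 2
  rwa [mul_pow, ← vecNorm, vecNorm_sq, vecNorm_sq] at h

theorem frobNorm_mul_le_mul_specNorm {m n p : Type*} [Fintype m] [Fintype n] [Fintype p]
    [DecidableEq n] [DecidableEq p] (A : Matrix m n ℝ) (B : Matrix n p ℝ) :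
    frobNorm (A * B) ≤ frobNorm A * specNorm B := by
  rw [← frobNorm_transpose, Matrix.transpose_mul, mul_comm, ← specNorm_transpose B,
    ← frobNorm_transpose A]
  exact frobNorm_mul_le_specNorm_mul _ _

theorem frobNorm_map_le {m n : Type*} [Fintype m] [Fintype n] (A : Matrix m n ℝ) {σ : ℝ → ℝ}
    {ρ : ℝ} (hρ : 0 ≤ ρ) (hσ : ∀ a, |σ a| ≤ ρ * |a|) :
    frobNorm (A.map σ) ≤ ρ * frobNorm A := by
  refine le_of_pow_le_pow_left₀ two_ne_zero (mul_nonneg hρ (frobNorm_nonneg A)) ?_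
  rw [mul_pow, frobNorm_sq, frobNorm_sq, Finset.mul_sum]
  refine Finset.sum_le_sum fun i _ => ?_
  rw [Finset.mul_sum]
  refine Finset.sum_le_sum fun j _ => ?_
  rw [Matrix.map_apply, ← sq_abs, ← sq_abs (A i j), ← mul_pow]
  exact pow_le_pow_left₀ (abs_nonneg _) (hσ _) 2

theorem vecNorm_avgPool_le {v p : Type*} [Fintype v] [Fintype p] (X : Matrix v p ℝ) :
    vecNorm (avgPool X) ≤ 1 / Real.sqrt (Fintype.card v) * frobNorm X := by
  refine le_of_pow_le_pow_left₀ two_ne_zero (mul_nonneg (by positivity) (frobNorm_nonneg X)) ?_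
  rw [mul_pow, frobNorm_sq, vecNorm_sq, Finset.sum_comm, Finset.mul_sum, div_pow, one_pow,
    Real.sq_sqrt (Nat.cast_nonneg _)]
  refine Finset.sum_le_sum fun j _ => ?_
  rw [avgPool, div_pow]
  rcases (Nat.cast_nonneg (α := ℝ) (Fintype.card v)).eq_or_lt with h | h
  · simp [← h]
  · have hcs := sq_sum_le_card_mul_sum_sq (s := Finset.univ) (f := fun i => X i j)
    rw [Finset.card_univ] at hcs
    rw [div_le_iff₀ (by positivity)]
    refine hcs.trans (le_of_eq ?_)
    field_simp

theorem specNorm_normAdj_le {v : Type*} [Fintype v] [DecidableEq v] [Nonempty v] (A : Matrix v v ℝ)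
    {α β : ℝ} (hα : 0 ≤ α) (hdeg : ∀ i, α ≤ ∑ j, A i j) (hA : specNorm A ≤ β) :
    specNorm (normAdj A) ≤ (1 + β) * (1 + α)⁻¹ := by
  rw [specNorm_eq_l2_opNorm] at hA ⊢
  have hdiag : ‖Matrix.diagonal fun i => (Real.sqrt (∑ j, (1 + A) i j))⁻¹‖ ≤
      (Real.sqrt (1 + α))⁻¹ := by
    rw [Matrix.l2_opNorm_diagonal, pi_norm_le_iff_of_nonneg (by positivity)]
    intro i
    rw [Real.norm_of_nonneg (by positivity)]
    have hrow : 1 + α ≤ ∑ j, (1 + A) i j := by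
      simpa [Matrix.add_apply, Finset.sum_add_distrib, Matrix.one_apply] using hdeg i
    gcongr
  have hadj : ‖1 + A‖ ≤ 1 + β :=
    norm_add_le_of_le norm_one.le hA
  have hβ : 0 ≤ 1 + β := (norm_nonneg _).trans hadj
  calc ‖normAdj A‖
      ≤ (Real.sqrt (1 + α))⁻¹ * (1 + β) * (Real.sqrt (1 + α))⁻¹ := by
        refine (norm_mul_le _ _).trans (mul_le_mul ((norm_mul_le _ _).trans ?_) hdiag
          (norm_nonneg _) (by positivity))
        exact mul_le_mul hdiag hadj (norm_nonneg _) (by positivity)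
    _ = (1 + β) * (1 + α)⁻¹ := by
        rw [mul_comm _ (1 + β), mul_assoc, ← mul_inv, Real.mul_self_sqrt (by positivity)]

theorem frobNorm_gcn_le {v : Type*} [Fintype v] [DecidableEq v] (U : Matrix v v ℝ) {σ : ℝ → ℝ}
    {d : ℕ → ℕ} (W : (l : ℕ) → Matrix (Fin (d l)) (Fin (d (l + 1))) ℝ)
    (X : Matrix v (Fin (d 0)) ℝ) {ρ u w : ℝ} (hρ : 0 ≤ ρ) (hσ : ∀ a, |σ a| ≤ ρ * |a|)
    (hU : specNorm U ≤ u) (L : ℕ) (hW : ∀ l < L, specNorm (W l) ≤ w) :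
    frobNorm (gcn U σ W X L) ≤ ρ ^ L * w ^ L * u ^ L * frobNorm X := by
  have hu : 0 ≤ u := (specNorm_nonneg U).trans hU
  induction L with
  | zero => simp [gcn]
  | succ l ih =>
    have ih := ih fun k hk => hW k (hk.trans l.lt_succ_self)
    have hWl := hW l l.lt_succ_self
    calc frobNorm (gcn U σ W X (l + 1))
        ≤ ρ * frobNorm (U * gcn U σ W X l * W l) := frobNorm_map_le _ hρ hσ
      _ ≤ ρ * (u * (ρ ^ l * w ^ l * u ^ l * frobNorm X) * w) := by
        refine mul_le_mul_of_nonneg_left ?_ hρ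
        refine (frobNorm_mul_le_mul_specNorm _ _).trans (mul_le_mul ?_ hWl (specNorm_nonneg _)
          (mul_nonneg hu ((frobNorm_nonneg _).trans ih)))
        exact (frobNorm_mul_le_specNorm_mul _ _).trans
          (mul_le_mul hU ih (frobNorm_nonneg _) hu)
      _ = ρ ^ (l + 1) * w ^ (l + 1) * u ^ (l + 1) * frobNorm X := by ring

theorem vecNorm_convex_sum_le {ι κ : Type*} [Fintype ι] [Fintype κ] {c : κ → ℝ} (f : κ → ι → ℝ)
    {B : ℝ} (hc : ∀ k, 0 ≤ c k) (hsum : ∑ k, c k = 1) (hf : ∀ k, vecNorm (f k) ≤ B) :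
    vecNorm (fun i => ∑ k, c k * f k i) ≤ B := by
  have hlin : WithLp.toLp 2 (fun i => ∑ k, c k * f k i) = ∑ k, c k • WithLp.toLp 2 (f k) := by
    ext i
    simp
  rw [vecNorm_eq_norm_toLp, hlin]
  calc ‖∑ k, c k • WithLp.toLp 2 (f k)‖
      ≤ ∑ k, c k * B := by
        refine norm_sum_le_of_le _ fun k _ => ?_
        rw [norm_smul, Real.norm_of_nonneg (hc k), ← vecNorm_eq_norm_toLp]
        exact mul_le_mul_of_nonneg_left (hf k) (hc k)
    _ = B := by rw [← Finset.sum_mul, hsum, one_mul]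

end NormBounds

theorem ensemble_representation_norm_le {n M : ℕ} {d : ℕ → ℕ} (hn : 0 < n)
    (A : Matrix (Fin n) (Fin n) ℝ) (X : Matrix (Fin n) (Fin (d 0)) ℝ)
    (W : Fin M → (l : ℕ) → Matrix (Fin (d l)) (Fin (d (l + 1))) ℝ)
    (L : ℕ) (σ : ℝ → ℝ) (lam : Fin M → ℝ)
    (α βA βX βW ρ : ℝ)
    (hsymm : A.IsSymm) (hnonneg : ∀ i j, 0 ≤ A i j)
    (hα : 0 ≤ α) (hdeg : ∀ i, α ≤ ∑ j, A i j) (hA : specNorm A ≤ βA)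
    (hX : frobNorm X ≤ βX) (hW : ∀ m, ∀ l < L, specNorm (W m l) ≤ βW)
    (hρ : 0 ≤ ρ) (hσ : ∀ a b : ℝ, |σ a - σ b| ≤ ρ * |a - b|) (hσ0 : σ 0 = 0)
    (hlam : ∀ m, 0 ≤ lam m) (hlamsum : ∑ m, lam m = 1) :
    vecNorm (ensembleRep A σ W X lam L) ≤
      (1 / Real.sqrt n) * ρ ^ L * βW ^ L * βX * (1 + βA) ^ L * ((1 + α) ^ L)⁻¹ := by
  have : Nonempty (Fin n) := ⟨⟨0, hn⟩⟩
  have hσ' : ∀ a, |σ a| ≤ ρ * |a| := fun a => by simpa [hσ0] using hσ a 0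
  have hU := specNorm_normAdj_le A hα hdeg hA
  refine vecNorm_convex_sum_le _ hlam hlamsum fun m => ?_
  have hgcn := frobNorm_gcn_le (normAdj A) (W m) X hρ hσ' hU L (hW m)
  have hc : 0 ≤ ρ ^ L * βW ^ L * ((1 + βA) * (1 + α)⁻¹) ^ L := by
    have hu := (specNorm_nonneg _).trans hU
    rcases L.eq_zero_or_pos with rfl | hL
    · simp
    · have hw := (specNorm_nonneg _).trans (hW m 0 hL)
      positivity
  calc vecNorm (avgPool (gcn (normAdj A) σ (W m) X L))
      ≤ 1 / Real.sqrt n * frobNorm (gcn (normAdj A) σ (W m) X L) := by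
        simpa using vecNorm_avgPool_le (gcn (normAdj A) σ (W m) X L)
    _ ≤ 1 / Real.sqrt n * (ρ ^ L * βW ^ L * ((1 + βA) * (1 + α)⁻¹) ^ L * βX) := by
        refine mul_le_mul_of_nonneg_left (hgcn.trans ?_) (by positivity)
        exact mul_le_mul_of_nonneg_left hX hc
    _ = _ := by rw [mul_pow, inv_pow]; ring
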